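/- Let l ≥ 3 be odd and s ≥ 3, and let G(s,l) be the graph consisting of a cycle of length s together with s pairwise vertex-disjoint cycles of length l, the i-th of which shares exactly one vertex with the central cycle, namely its i-th vertex. Let C be the circuit of I_{G(s,l)} corresponding to two of the attached l-cycles joined by a path of length s − 1 inside the central cycle, so that deg(C) = l + s − 1. Then the index of C equals 1, i.e. the lattice ℤ·supp(C) equals ℝ·supp(C) ∩ ℤA_{G(s,l)}; consequently the true degree of C equals its ordinary degree l + s − 1. -/

import Mathlib

open MvPolynomial

noncomputable section

/-! ### Term orders, initial terms, (reduced) Gröbner bases, universal Gröbner basis -/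

/-- A term order on the monomials (exponent vectors) in variables indexed by `σ`:
a linear order for which `0` is least and which is compatible with addition. -/
structure TermOrder (σ : Type*) where
  lo : LinearOrder (σ →₀ ℕ)
  zero_min : ∀ u : σ →₀ ℕ, lo.le 0 u
  add_right : ∀ u v w : σ →₀ ℕ, lo.le u v → lo.le (u + w) (v + w)

variable {σ : Type*} {K : Type*} [Field K]

/-- The leading (largest) exponent of a polynomial with respect to a term order
(junk value `0` if `f = 0`). -/
def TermOrder.leadExp (t : TermOrder σ) (f : MvPolynomial σ K) : σ →₀ ℕ :=
  haveI := Classical.propDecidable (f = 0)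
  if h : f = 0 then 0
  else @Finset.max' _ t.lo f.support
    (Finset.nonempty_iff_ne_empty.mpr fun he => h (MvPolynomial.support_eq_empty.mp he))

/-- The initial term of a polynomial with respect to a term order. -/
def TermOrder.initial (t : TermOrder σ) (f : MvPolynomial σ K) : MvPolynomial σ K :=
  monomial (t.leadExp f) (f.coeff (t.leadExp f))

/-- `𝒢` is a Gröbner basis of `I` w.r.t. the term order `t`. -/
def IsGroebnerBasis (t : TermOrder σ) (I : Ideal (MvPolynomial σ K))
    (𝒢 : Finset (MvPolynomial σ K)) : Prop :=
  (𝒢 : Set (MvPolynomial σ K)) ⊆ (I : Set (MvPolynomial σ K)) ∧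
    Ideal.span (t.initial '' (𝒢 : Set (MvPolynomial σ K))) =
      Ideal.span (t.initial '' (I : Set (MvPolynomial σ K)))

/-- `𝒢` is a reduced Gröbner basis of `I` w.r.t. `t`: a Gröbner basis, all of whose elements
are monic, and no monomial occurring in an element of `𝒢` is divisible by the initial term of
a different element of `𝒢`. -/
def IsReducedGroebnerBasis (t : TermOrder σ) (I : Ideal (MvPolynomial σ K))
    (𝒢 : Finset (MvPolynomial σ K)) : Prop :=
  IsGroebnerBasis t I 𝒢 ∧
    (∀ g ∈ 𝒢, g.coeff (t.leadExp g) = 1) ∧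
    (∀ g ∈ 𝒢, ∀ g' ∈ 𝒢, g' ≠ g → ∀ u ∈ g.support, ¬ t.leadExp g' ≤ u)

/-- The universal Gröbner basis of `I`: the union of all reduced Gröbner bases of `I`
over all term orders. -/
def UniversalGB (I : Ideal (MvPolynomial σ K)) : Set (MvPolynomial σ K) :=
  {f | ∃ (t : TermOrder σ) (𝒢 : Finset (MvPolynomial σ K)),
    IsReducedGroebnerBasis t I 𝒢 ∧ f ∈ 𝒢}

/-! ### Binomials, primitive binomials (Graver basis), circuits -/

/-- The binomial `x^u - x^v`. -/
def binom (K : Type*) [Field K] {σ : Type*} (u v : σ →₀ ℕ) : MvPolynomial σ K :=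
  monomial u 1 - monomial v 1

/-- `f` is a primitive binomial of `I`: `f = x^u - x^v ∈ I` and there is no other binomial
`x^w - x^z ∈ I` with `x^w ∣ x^u` and `x^z ∣ x^v`.  The set of primitive binomials of `I`
is the Graver basis of `I`. -/
def IsPrimitiveBinomial (I : Ideal (MvPolynomial σ K)) (f : MvPolynomial σ K) : Prop :=
  ∃ u v : σ →₀ ℕ, u ≠ v ∧ f = binom K u v ∧ f ∈ I ∧
    ∀ w z : σ →₀ ℕ, w ≠ z → binom K w z ∈ I → w ≤ u → z ≤ v → w = u ∧ z = v

/-- `f` is a circuit of `I`: an irreducible binomial of `I` whose support (set of variables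
occurring in it) is minimal among the supports of nonzero binomials of `I`. -/
def IsCircuitBinomial (I : Ideal (MvPolynomial σ K)) (f : MvPolynomial σ K) : Prop :=
  (∃ u v : σ →₀ ℕ, u ≠ v ∧ f = binom K u v) ∧ f ∈ I ∧ Irreducible f ∧
    ∀ g : MvPolynomial σ K, (∃ u v : σ →₀ ℕ, u ≠ v ∧ g = binom K u v) → g ∈ I →
      g.vars ⊆ f.vars → g.vars = f.vars

/-- The toric ideal of a vector configuration `A = (a_1, …, a_m) ⊆ ℕ^n`: the ideal generated
by all binomials `x^u - x^v` with `Σ uᵢ aᵢ = Σ vᵢ aᵢ`. -/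
def toricIdealOfConfig (K : Type*) [Field K] {m n : ℕ} (A : Fin m → Fin n → ℕ) :
    Ideal (MvPolynomial (Fin m) K) :=
  Ideal.span {f | ∃ u v : Fin m →₀ ℕ,
    f = binom K u v ∧ (∑ i, u i • A i) = ∑ i, v i • A i}

/-! ### Toric ideals of graphs -/

variable {V : Type*}

/-- The image `x_u * x_v` of an edge `e = {u, v}`. -/
def edgeImage (K : Type*) [Field K] {V : Type*} (e : Sym2 V) : MvPolynomial V K :=
  Sym2.lift ⟨fun a b => X a * X b, fun a b => mul_comm _ _⟩ e

/-- The toric ideal `I_G` of a graph `G`: the kernel of the `K`-algebra map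
`K[e : e ∈ E(G)] → K[x_v : v ∈ V(G)]`, `e = {u,v} ↦ x_u x_v`. -/
def graphToricIdeal (K : Type*) [Field K] (G : SimpleGraph V) :
    Ideal (MvPolynomial G.edgeSet K) :=
  RingHom.ker (MvPolynomial.aeval
    (fun e : G.edgeSet => edgeImage K (e : Sym2 V)) :
      MvPolynomial G.edgeSet K →ₐ[K] MvPolynomial V K).toRingHom

/-- An even closed walk `(v_0, v_1, …, v_{2q} = v_0)` in a graph `G`;
edges and vertices may repeat. -/
structure EvenClosedWalk (G : SimpleGraph V) where
  q : ℕ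
  verts : ℕ → V
  adj : ∀ i, i < 2 * q → G.Adj (verts i) (verts (i + 1))
  closed : verts (2 * q) = verts 0

namespace EvenClosedWalk

variable {G : SimpleGraph V}

/-- The `i`-th edge of the walk, as an element of the edge set of `G`. -/
def edge (w : EvenClosedWalk G) (i : ℕ) (h : i < 2 * w.q) : G.edgeSet :=
  ⟨s(w.verts i, w.verts (i + 1)), w.adj i h⟩

/-- The exponent vector `w⁺` of the monomial `E⁺(w)`, the product of the edges of `w`
in odd position (`1`-indexed). -/
def plusExp (w : EvenClosedWalk G) : G.edgeSet →₀ ℕ :=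
  ∑ k : Fin w.q, Finsupp.single (w.edge (2 * (k : ℕ)) (by have := k.isLt; omega)) 1

/-- The exponent vector `w⁻` of the monomial `E⁻(w)`, the product of the edges of `w`
in even position (`1`-indexed). -/
def minusExp (w : EvenClosedWalk G) : G.edgeSet →₀ ℕ :=
  ∑ k : Fin w.q, Finsupp.single (w.edge (2 * (k : ℕ) + 1) (by have := k.isLt; omega)) 1

end EvenClosedWalk

/-- The monomial `E⁺(w)`. -/
def Eplus (K : Type*) [Field K] {G : SimpleGraph V} (w : EvenClosedWalk G) :
    MvPolynomial G.edgeSet K :=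
  monomial w.plusExp 1

/-- The monomial `E⁻(w)`. -/
def Eminus (K : Type*) [Field K] {G : SimpleGraph V} (w : EvenClosedWalk G) :
    MvPolynomial G.edgeSet K :=
  monomial w.minusExp 1

/-- The binomial `B_w = E⁺(w) - E⁻(w)` of an even closed walk. -/
def Bw (K : Type*) [Field K] {G : SimpleGraph V} (w : EvenClosedWalk G) :
    MvPolynomial G.edgeSet K :=
  binom K w.plusExp w.minusExp

namespace EvenClosedWalk

variable {G : SimpleGraph V}

/-- The number of positions of the walk at which the edge `e` appears. -/
def count [DecidableEq V] (w : EvenClosedWalk G) (e : Sym2 V) : ℕ :=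
  ((Finset.range (2 * w.q)).filter fun i => e = s(w.verts i, w.verts (i + 1))).card

/-- The subgraph `𝐰` of `G` spanned by the edges of the walk `w`. -/
def graph (w : EvenClosedWalk G) : SimpleGraph V :=
  SimpleGraph.fromEdgeSet {e | ∃ i, ∃ _ : i < 2 * w.q, e = s(w.verts i, w.verts (i + 1))}

/-- The set `w⁺` of edges of `w` in odd position (`1`-indexed). -/
def plusEdges (w : EvenClosedWalk G) : Set (Sym2 V) :=
  {e | ∃ k, ∃ _ : k < w.q, e = s(w.verts (2 * k), w.verts (2 * k + 1))}

/-- The set `w⁻` of edges of `w` in even position (`1`-indexed). -/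
def minusEdges (w : EvenClosedWalk G) : Set (Sym2 V) :=
  {e | ∃ k, ∃ _ : k < w.q, e = s(w.verts (2 * k + 1), w.verts (2 * k + 2))}

/-- An even closed walk is primitive if it is nontrivial and there is no even closed
subwalk `ξ` of smaller length with `E⁺(ξ) ∣ E⁺(w)` and `E⁻(ξ) ∣ E⁻(w)`. -/
def IsPrimitive (w : EvenClosedWalk G) : Prop :=
  0 < w.q ∧ ∀ ξ : EvenClosedWalk G, 0 < ξ.q → ξ.q < w.q →
    ¬(ξ.plusExp ≤ w.plusExp ∧ ξ.minusExp ≤ w.minusExp)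

/-- The walk `w` is a cycle: it visits no vertex twice. -/
def IsCycle (w : EvenClosedWalk G) : Prop :=
  2 ≤ w.q ∧ ∀ i j, i < 2 * w.q → j < 2 * w.q → w.verts i = w.verts j → i = j

end EvenClosedWalk

/-! ### Cut vertices, cut edges, blocks, sinks -/

/-- `v` is a cut vertex of `H`: removing `v` (and the edges through it) disconnects two
vertices different from `v` that were connected in `H`. -/
def IsCutVertex (H : SimpleGraph V) (v : V) : Prop :=
  ∃ a b, a ≠ v ∧ b ≠ v ∧ H.Reachable a b ∧
    ¬(SimpleGraph.fromEdgeSet {e | e ∈ H.edgeSet ∧ v ∉ e}).Reachable a b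

/-- `e` is a cut edge of `H`: removing it disconnects two vertices connected in `H`. -/
def IsCutEdge (H : SimpleGraph V) (e : Sym2 V) : Prop :=
  e ∈ H.edgeSet ∧ ∃ a b, H.Reachable a b ∧ ¬(H.deleteEdges {e}).Reachable a b

/-- `H` is biconnected: it has an edge, it is connected (on its support),
and it has no cut vertex. -/
def IsBiconnected (H : SimpleGraph V) : Prop :=
  H.edgeSet.Nonempty ∧ (∀ a ∈ H.support, ∀ b ∈ H.support, H.Reachable a b) ∧
    ∀ v, ¬IsCutVertex H v

/-- `B` is a block of `H`: a maximal biconnected subgraph. -/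
def IsBlock (H B : SimpleGraph V) : Prop :=
  B ≤ H ∧ IsBiconnected B ∧ ∀ B', B ≤ B' → B' ≤ H → IsBiconnected B' → B' = B

/-- A graph is a cycle (graph): its edge set is the edge set of a cycle of length `≥ 3`. -/
def IsCycleGraph (B : SimpleGraph V) : Prop :=
  ∃ (n : ℕ) (f : ℕ → V), 3 ≤ n ∧
    (∀ i j, i < n → j < n → f i = f j → i = j) ∧
    B.edgeSet = {e | ∃ i, ∃ _ : i < n, e = s(f i, f ((i + 1) % n))}

/-- `v` is a sink of the block `B` of the walk `w`: a common vertex of two odd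
(or two even) edges of the walk belonging to `B`. -/
def IsSinkOf {G : SimpleGraph V} (w : EvenClosedWalk G) (B : SimpleGraph V) (v : V) : Prop :=
  ∃ e₁ e₂ : Sym2 V, e₁ ≠ e₂ ∧ e₁ ∈ B.edgeSet ∧ e₂ ∈ B.edgeSet ∧ v ∈ e₁ ∧ v ∈ e₂ ∧
    ((e₁ ∈ w.plusEdges ∧ e₂ ∈ w.plusEdges) ∨ (e₁ ∈ w.minusEdges ∧ e₂ ∈ w.minusEdges))

/-- `B` is a pure cyclic block of the walk `w`: a block of `𝐰` which is a cycle all of whose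
edges lie in `w⁺`, or all in `w⁻`. -/
def IsPureCyclicBlock {G : SimpleGraph V} (w : EvenClosedWalk G) (B : SimpleGraph V) : Prop :=
  IsBlock w.graph B ∧ IsCycleGraph B ∧
    (B.edgeSet ⊆ w.plusEdges ∨ B.edgeSet ⊆ w.minusEdges)

/-- A primitive walk is mixed if it has no pure cyclic block. -/
def EvenClosedWalk.IsMixed {G : SimpleGraph V} (w : EvenClosedWalk G) : Prop :=
  ∀ B : SimpleGraph V, ¬IsPureCyclicBlock w B


/-- The graph `G(s, l)`: a central cycle of length `s` (on the vertices `(i, 0)`), together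
with `s` pairwise vertex-disjoint cycles of length `l` (the `i`-th on the vertices `(i, j)`),
the `i`-th of which meets the central cycle exactly in its `i`-th vertex `(i, 0)`. -/
def Gsl (s l : ℕ) : SimpleGraph (ZMod s × ZMod l) :=
  SimpleGraph.fromEdgeSet
    ({e | ∃ i : ZMod s, e = s((i, (0 : ZMod l)), (i + 1, (0 : ZMod l)))} ∪
     {e | ∃ (i : ZMod s) (j : ZMod l), e = s((i, j), (i, j + 1))})

/-- The vector `a_e = u + v ∈ ℤ^V` associated to an edge `e = {u, v}`. -/
def edgeVec {V : Type*} [DecidableEq V] (e : Sym2 V) : V → ℤ :=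
  Sym2.lift ⟨fun a b v => (if v = a then 1 else 0) + (if v = b then 1 else 0),
    fun a b => funext fun v => add_comm _ _⟩ e

/-- The support (as a set of edges of `G(s,l)`) of the circuit consisting of the two attached
`l`-cycles at the central vertices `0` and `1`, joined by the path of length `s - 1` inside the
central cycle avoiding the central edge `{(0,0), (1,0)}`. -/
def circuitSupport (s l : ℕ) : Set (Sym2 (ZMod s × ZMod l)) :=
  {e | ∃ j : ZMod l, e = s(((0 : ZMod s), j), ((0 : ZMod s), j + 1))} ∪
  {e | ∃ j : ZMod l, e = s(((1 : ZMod s), j), ((1 : ZMod s), j + 1))} ∪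
  {e | ∃ i : ZMod s, i ≠ 0 ∧ e = s((i, (0 : ZMod l)), (i + 1, (0 : ZMod l)))}

/-! ### The lattice of the circuit -/

theorem edgeVec_mk {V : Type*} [DecidableEq V] (a b : V) :
    edgeVec s(a, b) = Pi.single a 1 + Pi.single b 1 := by
  funext v
  simp [edgeVec, Pi.single_apply]

theorem ZMod.natCast_ne_zero_of_lt {n k : ℕ} (hk : 0 < k) (hkn : k < n) : (k : ZMod n) ≠ 0 := by
  rw [Ne, ZMod.natCast_eq_zero_iff]
  exact Nat.not_dvd_of_pos_of_lt hk hkn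

theorem ZMod.one_ne_zero_of_three_le {n : ℕ} (hn : 3 ≤ n) : (1 : ZMod n) ≠ 0 := by
  simpa using ZMod.natCast_ne_zero_of_lt (n := n) (k := 1) (by omega) (by omega)

theorem ZMod.one_add_one_ne_zero_of_three_le {n : ℕ} (hn : 3 ≤ n) : (1 + 1 : ZMod n) ≠ 0 := by
  have h := ZMod.natCast_ne_zero_of_lt (n := n) (k := 2) (by omega) (by omega)
  rw [one_add_one_eq_two]
  exact_mod_cast h

theorem central_mem_edgeSet {s l : ℕ} (hs : 3 ≤ s) (i : ZMod s) :
    s((i, (0 : ZMod l)), (i + 1, (0 : ZMod l))) ∈ (Gsl s l).edgeSet := by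
  rw [Gsl, SimpleGraph.edgeSet_fromEdgeSet]
  refine ⟨Or.inl ⟨i, rfl⟩, ?_⟩
  simpa using ZMod.one_ne_zero_of_three_le hs

theorem attached_mem_edgeSet {s l : ℕ} (hl : 3 ≤ l) (i : ZMod s) (j : ZMod l) :
    s((i, j), (i, j + 1)) ∈ (Gsl s l).edgeSet := by
  rw [Gsl, SimpleGraph.edgeSet_fromEdgeSet]
  refine ⟨Or.inr ⟨i, j, rfl⟩, ?_⟩
  simpa using ZMod.one_ne_zero_of_three_le hl

theorem circuitSupport_subset_edgeSet {s l : ℕ} (hs : 3 ≤ s) (hl : 3 ≤ l) :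
    circuitSupport s l ⊆ (Gsl s l).edgeSet := by
  rintro e ((⟨j, rfl⟩ | ⟨j, rfl⟩) | ⟨i, -, rfl⟩)
  · exact attached_mem_edgeSet hl 0 j
  · exact attached_mem_edgeSet hl 1 j
  · exact central_mem_edgeSet hs i

theorem cast_mem_span_of_mem_closure {V : Type*} [DecidableEq V] (S : Set (Sym2 V)) {x : V → ℤ}
    (hx : x ∈ AddSubgroup.closure (edgeVec '' S)) :
    (fun v => (x v : ℝ)) ∈ Submodule.span ℝ
      ((fun e : Sym2 V => fun v => ((edgeVec e v : ℤ) : ℝ)) '' S) := by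
  induction hx using AddSubgroup.closure_induction with
  | mem x hx =>
    obtain ⟨e, he, rfl⟩ := hx
    exact Submodule.subset_span ⟨e, he, rfl⟩
  | zero =>
    simp only [Pi.zero_apply, Int.cast_zero]
    exact Submodule.zero_mem _
  | add x y _ _ hx hy =>
    simp only [Pi.add_apply, Int.cast_add]
    exact Submodule.add_mem _ hx hy
  | neg x _ hx =>
    simp only [Pi.neg_apply, Int.cast_neg]
    exact Submodule.neg_mem _ hx

theorem even_sum_of_mem_closure {V : Type*} [DecidableEq V] [Fintype V] (S : Set (Sym2 V))
    {x : V → ℤ} (hx : x ∈ AddSubgroup.closure (edgeVec '' S)) : Even (∑ v, x v) := by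
  induction hx using AddSubgroup.closure_induction with
  | mem x hx =>
    obtain ⟨e, -, rfl⟩ := hx
    induction e using Sym2.ind with
    | _ a b => simp [edgeVec_mk, Finset.sum_add_distrib]
  | zero => simp
  | add x y _ _ hx hy =>
    simpa [Finset.sum_add_distrib] using hx.add hy
  | neg x _ hx => simpa using hx

/-- A vector in the real span of the edge vectors vanishes at the vertices which are not
covered by the edges. -/
theorem eq_zero_of_cast_mem_span {V : Type*} [DecidableEq V] (S : Set (Sym2 V)) {y : V → ℝ}
    (hy : y ∈ Submodule.span ℝ
      ((fun e : Sym2 V => fun v => ((edgeVec e v : ℤ) : ℝ)) '' S))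
    {v : V} (hv : ∀ e ∈ S, v ∉ e) : y v = 0 := by
  induction hy using Submodule.span_induction with
  | mem y hy =>
    obtain ⟨e, he, rfl⟩ := hy
    have := hv e he
    induction e using Sym2.ind with
    | _ a b =>
      rw [Sym2.mem_iff, not_or] at this
      simp [edgeVec, this.1, this.2]
  | zero => rfl
  | add x y _ _ hx hy => simp [hx, hy]
  | smul c x _ hx => simp [hx]

theorem single_sub_mem {V : Type*} [DecidableEq V] {L : AddSubgroup (V → ℤ)} {r a b : V}
    (hr : (Pi.single r 1 + Pi.single r 1 : V → ℤ) ∈ L)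
    (ha : (Pi.single a 1 - Pi.single r 1 : V → ℤ) ∈ L)
    (hab : (Pi.single a 1 + Pi.single b 1 : V → ℤ) ∈ L) :
    (Pi.single b 1 - Pi.single r 1 : V → ℤ) ∈ L := by
  convert L.sub_mem (L.sub_mem hab ha) hr using 1
  abel

/-- Going once around an odd cycle puts twice a vertex of it into the lattice. -/
theorem single_add_single_mem_of_odd_cycle {V : Type*} [DecidableEq V]
    {L : AddSubgroup (V → ℤ)} {l : ℕ} (hodd : Odd l) (f : ZMod l → V)
    (hf : ∀ j, (Pi.single (f j) 1 + Pi.single (f (j + 1)) 1 : V → ℤ) ∈ L) :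
    (Pi.single (f 0) 1 + Pi.single (f 0) 1 : V → ℤ) ∈ L := by
  have key : ∀ k : ℕ, (Pi.single (f k) 1 - (-1 : ℤ) ^ k • Pi.single (f 0) 1 : V → ℤ) ∈ L := by
    intro k
    induction k with
    | zero => simp
    | succ k ih =>
      convert L.sub_mem (hf k) ih using 1
      rw [pow_succ]
      push_cast
      simp only [mul_neg, mul_one, neg_smul]
      abel
  simpa [hodd.neg_one_pow] using key l

/-- If the lattice contains all differences with a root vertex `r` over `W` and twice the root,
then it contains all vectors supported on `W` of even coordinate sum. -/
theorem mem_of_even_sum {V : Type*} [DecidableEq V] [Fintype V] {L : AddSubgroup (V → ℤ)} {r : V}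
    (hr : (Pi.single r 1 + Pi.single r 1 : V → ℤ) ∈ L) {x : V → ℤ}
    (hx : ∀ v, x v ≠ 0 → (Pi.single v 1 - Pi.single r 1 : V → ℤ) ∈ L)
    (heven : Even (∑ v, x v)) : x ∈ L := by
  obtain ⟨m, hm⟩ := heven
  have hdec : x = ∑ v, x v • (Pi.single v 1 - Pi.single r 1 : V → ℤ)
      + m • (Pi.single r 1 + Pi.single r 1 : V → ℤ) := by
    simp only [smul_sub, Finset.sum_sub_distrib, ← Finset.sum_smul, hm]
    funext v
    simp only [Pi.add_apply, Pi.sub_apply, Finset.sum_apply, Pi.smul_apply, Pi.single_apply]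
    split_ifs <;> simp
    ring
  rw [hdec]
  refine L.add_mem (L.sum_mem fun v _ => ?_) (L.zsmul_mem hr m)
  by_cases h : x v = 0
  · simp [h]
  · exact L.zsmul_mem (hx v h) _

theorem single_sub_single_mem_circuit_lattice {s l : ℕ} (hs : 3 ≤ s) (hl : 3 ≤ l)
    (hr : (Pi.single (0, 0) 1 + Pi.single (0, 0) 1 : ZMod s × ZMod l → ℤ) ∈
      AddSubgroup.closure (edgeVec '' circuitSupport s l))
    (i : ZMod s) (j : ZMod l) (hij : j = 0 ∨ i = 0 ∨ i = 1) :
    (Pi.single (i, j) 1 - Pi.single (0, 0) 1 : ZMod s × ZMod l → ℤ) ∈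
      AddSubgroup.closure (edgeVec '' circuitSupport s l) := by
  have : NeZero s := ⟨by omega⟩
  have : NeZero l := ⟨by omega⟩
  set L := AddSubgroup.closure (edgeVec '' circuitSupport s l)
  have hcentral : ∀ k : ℕ, k < s →
      (Pi.single (-(k : ZMod s), 0) 1 - Pi.single (0, 0) 1 : ZMod s × ZMod l → ℤ) ∈ L := by
    intro k
    induction k with
    | zero => simp
    | succ k ih =>
      intro hk
      refine single_sub_mem hr (ih (by omega)) ?_
      rw [add_comm, ← edgeVec_mk]
      refine AddSubgroup.subset_closure ⟨_, Or.inr ⟨-((k + 1 : ℕ) : ZMod s), ?_, rfl⟩, ?_⟩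
      · exact neg_ne_zero.mpr (ZMod.natCast_ne_zero_of_lt (by omega) hk)
      · congr 4
        push_cast
        ring
  have hcentral' : ∀ i : ZMod s,
      (Pi.single (i, 0) 1 - Pi.single (0, 0) 1 : ZMod s × ZMod l → ℤ) ∈ L := by
    intro i
    have := hcentral (-i).val (ZMod.val_lt _)
    rwa [ZMod.natCast_zmod_val, neg_neg] at this
  have hattached : ∀ i : ZMod s, (i = 0 ∨ i = 1) → ∀ k : ℕ,
      (Pi.single (i, (k : ZMod l)) 1 - Pi.single (0, 0) 1 : ZMod s × ZMod l → ℤ) ∈ L := by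
    intro i hi k
    induction k with
    | zero => simpa using hcentral' i
    | succ k ih =>
      refine single_sub_mem hr ih ?_
      rw [← edgeVec_mk]
      refine AddSubgroup.subset_closure ⟨_, Or.inl ?_, rfl⟩
      rcases hi with rfl | rfl
      · exact Or.inl ⟨k, by push_cast; rfl⟩
      · exact Or.inr ⟨k, by push_cast; rfl⟩
  rcases hij with rfl | hi
  · exact hcentral' i
  · have := hattached i hi j.val
    rwa [ZMod.natCast_zmod_val] at this

theorem mem_circuit_lattice_iff {s l : ℕ} (hs : 3 ≤ s) (hl : 3 ≤ l) (hodd : Odd l)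
    (x : ZMod s × ZMod l → ℤ) :
    x ∈ AddSubgroup.closure (edgeVec '' circuitSupport s l) ↔
      (x ∈ AddSubgroup.closure (edgeVec '' (Gsl s l).edgeSet) ∧
        (fun v => (x v : ℝ)) ∈ Submodule.span ℝ
          ((fun e : Sym2 (ZMod s × ZMod l) => fun v => ((edgeVec e v : ℤ) : ℝ)) ''
            circuitSupport s l)) := by
  have : NeZero s := ⟨by omega⟩
  have : NeZero l := ⟨by omega⟩
  refine ⟨fun hx => ⟨AddSubgroup.closure_mono
    (Set.image_mono (circuitSupport_subset_edgeSet hs hl)) hx,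
    cast_mem_span_of_mem_closure _ hx⟩, ?_⟩
  rintro ⟨hx, hspan⟩
  have hr := single_add_single_mem_of_odd_cycle
    (L := AddSubgroup.closure (edgeVec '' circuitSupport s l)) hodd
    (fun j => ((0 : ZMod s), j)) fun j => by
      rw [← edgeVec_mk]
      exact AddSubgroup.subset_closure ⟨_, Or.inl (Or.inl ⟨j, rfl⟩), rfl⟩
  refine mem_of_even_sum hr ?_ (even_sum_of_mem_closure _ hx)
  rintro ⟨i, j⟩ hij
  refine single_sub_single_mem_circuit_lattice hs hl hr i j ?_
  by_contra! hne
  obtain ⟨hj, hi0, hi1⟩ := hne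
  refine hij (Int.cast_eq_zero.mp
    (eq_zero_of_cast_mem_span (circuitSupport s l) hspan (v := (i, j)) ?_))
  rintro e ((⟨j', rfl⟩ | ⟨j', rfl⟩) | ⟨i', -, rfl⟩) <;> simp [hj, hi0, hi1]

/-! ### The binomials of the toric ideal -/

/-- The exponent vector of the monomial `x_u x_v` of an edge `e = {u, v}`. -/
def edgeExp {V : Type*} (e : Sym2 V) : V →₀ ℕ :=
  Sym2.lift ⟨fun a b => Finsupp.single a 1 + Finsupp.single b 1, fun _ _ => add_comm _ _⟩ e

theorem edgeImage_eq_monomial {V : Type*} (e : Sym2 V) :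
    edgeImage K e = monomial (edgeExp e) 1 := by
  induction e using Sym2.ind with
  | _ a b => simp [edgeImage, edgeExp, X, monomial_mul]

theorem sum_edgeExp_eq_of_binom_mem {V : Type*} {G : SimpleGraph V} [Fintype G.edgeSet]
    {u v : G.edgeSet →₀ ℕ} (h : binom K u v ∈ graphToricIdeal K G) :
    ∑ e, u e • edgeExp (e : Sym2 V) = ∑ e, v e • edgeExp (e : Sym2 V) := by
  have hmon : ∀ w : G.edgeSet →₀ ℕ,
      aeval (fun e : G.edgeSet => edgeImage K (e : Sym2 V)) (monomial w (1 : K)) =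
        monomial (∑ e, w e • edgeExp (e : Sym2 V)) (1 : K) := by
    intro w
    rw [aeval_monomial, Finsupp.prod_fintype _ _ (by simp), monomial_sum_one]
    simp [edgeImage_eq_monomial, monomial_pow]
  refine monomial_left_injective (R := K) one_ne_zero ?_
  simp only [← hmon]
  have h0 : aeval (fun e : G.edgeSet => edgeImage K (e : Sym2 V)) (binom K u v) = 0 := h
  rw [binom, map_sub, sub_eq_zero] at h0
  exact h0

theorem support_subset_vars_binom_left {u v : σ →₀ ℕ} (huv : u ≠ v) :
    u.support ⊆ (binom K u v).vars := by
  classical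
  intro e he
  rw [mem_vars_iff_mem_support]
  refine ⟨u, ?_, he⟩
  simp [binom, coeff_monomial, huv.symm]

theorem support_subset_vars_binom_right {u v : σ →₀ ℕ} (huv : u ≠ v) :
    v.support ⊆ (binom K u v).vars := by
  classical
  intro e he
  rw [mem_vars_iff_mem_support]
  refine ⟨v, ?_, he⟩
  simp [binom, coeff_monomial, huv]

theorem not_isUnit_binom (u v : σ →₀ ℕ) : ¬IsUnit (binom K u v) := by
  intro h
  have := h.map (eval (fun _ => (1 : K)))
  simp [binom, eval_monomial, Finsupp.prod] at this

/-- An irreducible homogeneous binomial whose exponent difference is a positive multiple of `w`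
has degree half the `ℓ¹`-norm of `w`. -/
theorem two_mul_totalDegree_of_irreducible_binom [Fintype σ] {u v : σ →₀ ℕ}
    (hirr : Irreducible (binom K u v)) (hdeg : ∑ e, u e = ∑ e, v e) {n : ℕ} (hn : 0 < n)
    {w : σ → ℤ} (hw : ∀ e, (u e : ℤ) - v e = n * w e) :
    2 * (binom K u v).totalDegree = ∑ e, (w e).natAbs := by
  let p : σ →₀ ℕ := Finsupp.equivFunOnFinite.symm fun e => (w e).toNat
  let q : σ →₀ ℕ := Finsupp.equivFunOnFinite.symm fun e => (-w e).toNat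
  have hpq : ∀ e, (p e : ℤ) - q e = w e := fun e => by
    simp only [p, q, Finsupp.equivFunOnFinite_symm_apply_apply]
    omega
  have hpq' : ∀ e, p e + q e = (w e).natAbs := fun e => by
    simp only [p, q, Finsupp.equivFunOnFinite_symm_apply_apply]
    omega
  have hpq0 : ∀ e, q e = 0 ∨ p e = 0 := fun e => by
    simp only [p, q, Finsupp.equivFunOnFinite_symm_apply_apply]
    omega
  have hle : ∀ e, n * p e ≤ u e ∧ u e - n * p e + n * q e = v e := fun e => by
    have h1 := hw e
    rw [← hpq e, mul_sub] at h1
    rcases hpq0 e with h | h <;> simp only [h, Nat.cast_zero, mul_zero] at h1 ⊢ <;>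
      refine ⟨?_, ?_⟩ <;> zify <;> lia
  let m : σ →₀ ℕ := u - n • p
  have hu : u = m + n • p := by
    ext e
    have := hle e
    simp [m]
    omega
  have hv : v = m + n • q := by
    ext e
    have := hle e
    simp [m]
    omega
  have hdvd : binom K p q ∣ binom K u v := by
    have : binom K u v = monomial m 1 * (monomial p 1 ^ n - monomial q 1 ^ n) := by
      rw [hu, hv]
      simp [binom, monomial_pow, mul_sub, monomial_mul]
    rw [this]
    exact (sub_dvd_pow_sub_pow _ _ n).mul_left _
  obtain ⟨g, hg⟩ := hdvd
  have hgunit : IsUnit g := (hirr.isUnit_or_isUnit hg).resolve_left (not_isUnit_binom p q)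
  have hne : binom K p q ≠ 0 := by
    intro h
    rw [h, zero_mul] at hg
    exact hirr.ne_zero hg
  have hpq_ne : p ≠ q := by
    rintro h
    simp [binom, h] at hne
  have hsum : ∑ e, p e = ∑ e, q e := by
    have h1 : (n : ℤ) * ∑ e, w e = 0 := by
      rw [Finset.mul_sum]
      simp only [← hw, Finset.sum_sub_distrib]
      rw [sub_eq_zero]
      exact_mod_cast hdeg
    have h2 : ∑ e, w e = 0 := by
      rcases mul_eq_zero.mp h1 with h | h
      · omega
      · exact h
    simp only [← hpq, Finset.sum_sub_distrib, sub_eq_zero] at h2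
    exact_mod_cast h2
  have hdegree : (binom K p q).totalDegree = ∑ e, p e := by
    refine le_antisymm ?_ ?_
    · refine (totalDegree_sub _ _).trans ?_
      rw [totalDegree_monomial _ one_ne_zero, totalDegree_monomial _ one_ne_zero,
        Finsupp.sum_fintype _ _ (by simp), Finsupp.sum_fintype _ _ (by simp), hsum, max_self]
    · classical
      rw [← Finsupp.sum_fintype p (fun _ k => k) (by simp)]
      refine le_totalDegree ?_
      simp [binom, coeff_monomial, hpq_ne.symm]
  rw [hg, totalDegree_mul_of_isDomain hne hgunit.ne_zero,
    (isUnit_iff_totalDegree_of_isReduced.mp hgunit).2, add_zero, hdegree, two_mul]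
  conv_lhs => arg 2; rw [hsum]
  rw [← Finset.sum_add_distrib]
  exact Finset.sum_congr rfl fun e _ => hpq' e

/-! ### The degree of the circuit -/

/-- The edges of `G(s,l)`: central edges are indexed by `ZMod s`, the edges of the attached cycles
by `ZMod s × ZMod l`. -/
def gslEdge {s l : ℕ} (hs : 3 ≤ s) (hl : 3 ≤ l) :
    ZMod s ⊕ ZMod s × ZMod l → (Gsl s l).edgeSet
  | Sum.inl i => ⟨_, central_mem_edgeSet hs i⟩
  | Sum.inr (i, j) => ⟨_, attached_mem_edgeSet hl i j⟩

theorem eq_of_pair_succ_eq_pair_succ {n : ℕ} (hn : 3 ≤ n) {i j : ZMod n}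
    (h : (i = j ∧ i + 1 = j + 1) ∨ (i = j + 1 ∧ i + 1 = j)) : i = j := by
  rcases h with h | ⟨h1, h2⟩
  · exact h.1
  · refine absurd ?_ (ZMod.one_add_one_ne_zero_of_three_le hn)
    rw [h1, add_assoc, add_eq_left] at h2
    exact h2

theorem gslEdge_bijective {s l : ℕ} (hs : 3 ≤ s) (hl : 3 ≤ l) :
    Function.Bijective (gslEdge hs hl) := by
  have h1 := ZMod.one_ne_zero_of_three_le hs
  have h2 := ZMod.one_ne_zero_of_three_le hl
  constructor
  · rintro (i | ⟨i, j⟩) (i' | ⟨i', j'⟩) h <;>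
      simp only [gslEdge, Subtype.mk.injEq, Sym2.eq_iff, Prod.mk.injEq] at h
    · rw [eq_of_pair_succ_eq_pair_succ hs (i := i) (j := i') (by tauto)]
    · exfalso
      rcases h with h | h
      · exact h1 (add_eq_left.mp (h.2.1.trans h.1.1.symm))
      · exact h1 (add_eq_left.mp (h.2.1.trans h.1.1.symm))
    · exfalso
      rcases h with h | h
      · exact h2 (add_eq_left.mp (h.2.2.trans h.1.2.symm))
      · exact h2 (add_eq_left.mp (h.2.2.trans h.1.2.symm))
    · rw [eq_of_pair_succ_eq_pair_succ hl (i := j) (j := j') (by tauto),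
        show i = i' by tauto]
  · rintro ⟨e, he⟩
    have he' := he
    rw [Gsl, SimpleGraph.edgeSet_fromEdgeSet] at he'
    rcases he' with ⟨⟨i, rfl⟩ | ⟨i, j, rfl⟩, -⟩
    · exact ⟨Sum.inl i, rfl⟩
    · exact ⟨Sum.inr (i, j), rfl⟩

theorem sum_edgeExp_apply {s l : ℕ} [NeZero s] [NeZero l] (hs : 3 ≤ s) (hl : 3 ≤ l)
    [Fintype (Gsl s l).edgeSet] (f : (Gsl s l).edgeSet → ℕ) (i : ZMod s) (j : ZMod l) :
    (∑ e, f e • edgeExp (e : Sym2 (ZMod s × ZMod l))) (i, j) =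
      (if j = 0 then f (gslEdge hs hl (Sum.inl i)) + f (gslEdge hs hl (Sum.inl (i - 1))) else 0) +
        (f (gslEdge hs hl (Sum.inr (i, j))) + f (gslEdge hs hl (Sum.inr (i, j - 1)))) := by
  rw [← (gslEdge_bijective hs hl).sum_comp, Fintype.sum_sum_type, Fintype.sum_prod_type]
  simp only [gslEdge, edgeExp, Sym2.lift_mk, Finsupp.add_apply, Finsupp.finsetSum_apply,
    Finsupp.smul_apply, Finsupp.single_apply, Prod.mk.injEq, smul_eq_mul, mul_add,
    Finset.sum_add_distrib, ← eq_sub_iff_add_eq, ite_and, mul_ite, mul_one, mul_zero]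
  simp [eq_comm (a := (0 : ZMod l))]
  split_ifs <;> simp

/-- A function on an odd cycle which changes sign at each step except at the base point is
constant up to sign, and takes the same value on both sides of the base point. -/
theorem alternating_on_odd_cycle {l : ℕ} (hl : 0 < l) (hodd : Odd l) {c : ZMod l → ℤ}
    (hc : ∀ j, j ≠ 0 → c j + c (j - 1) = 0) :
    c (0 - 1) = c 0 ∧ ∀ j, (c j).natAbs = (c 0).natAbs := by
  have : NeZero l := ⟨hl.ne'⟩
  have key : ∀ k : ℕ, k < l → c k = (-1) ^ k * c 0 := by
    intro k
    induction k with
    | zero => simp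
    | succ k ih =>
      intro hk
      have h := hc ((k + 1 : ℕ) : ZMod l) (ZMod.natCast_ne_zero_of_lt (by omega) hk)
      rw [Nat.cast_succ, add_sub_cancel_right, ih (by omega)] at h
      rw [Nat.cast_succ, pow_succ]
      linarith
  constructor
  · obtain ⟨m, rfl⟩ := hodd
    have h := key (2 * m) (by omega)
    rw [(even_two_mul m).neg_one_pow, one_mul] at h
    rw [← h]
    congr 1
    rw [sub_eq_iff_eq_add]
    exact_mod_cast (ZMod.natCast_self (2 * m + 1)).symm
  · intro j
    have h := key j.val (ZMod.val_lt j)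
    rw [ZMod.natCast_zmod_val] at h
    simp [h, Int.natAbs_mul, Int.natAbs_pow]

/-- An integer edge weighting supported on the circuit and with zero vertex sums has constant
absolute value on the two attached cycles, and twice that value on the central path. -/
theorem natAbs_eq_of_vertex_sum_eq_zero {s l : ℕ} (hs : 3 ≤ s) (hl : 3 ≤ l) (hodd : Odd l)
    {p : ZMod s → ℤ} {c : ZMod s → ZMod l → ℤ} (hp : p 0 = 0)
    (hc : ∀ i j, i ≠ 0 → i ≠ 1 → c i j = 0)
    (h : ∀ i j, (if j = 0 then p i + p (i - 1) else 0) + (c i j + c i (j - 1)) = 0) :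
    (∀ j, (c 0 j).natAbs = (c 0 0).natAbs) ∧ (∀ j, (c 1 j).natAbs = (c 0 0).natAbs) ∧
      ∀ i, i ≠ 0 → (p i).natAbs = 2 * (c 0 0).natAbs := by
  have : NeZero s := ⟨by omega⟩
  have hcyc : ∀ i, c i (0 - 1) = c i 0 ∧ ∀ j, (c i j).natAbs = (c i 0).natAbs := fun i =>
    alternating_on_odd_cycle (by omega) hodd fun j hj => by simpa [hj] using h i j
  have hbase : ∀ i, p i + p (i - 1) + (c i 0 + c i 0) = 0 := fun i => by
    have := h i 0
    rwa [if_pos rfl, (hcyc i).1] at this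
  have hpath : ∀ k : ℕ, k + 1 < s → (p (-((k + 1 : ℕ) : ZMod s))).natAbs = 2 * (c 0 0).natAbs := by
    intro k
    induction k with
    | zero =>
      intro _
      have := hbase 0
      rw [hp, zero_sub] at this
      simp only [zero_add, Nat.cast_one]
      omega
    | succ k ih =>
      intro hk
      have hb := hbase (-((k + 1 : ℕ) : ZMod s))
      have h1 : -((k + 1 : ℕ) : ZMod s) ≠ 1 := by
        intro h1
        rw [neg_eq_iff_add_eq_zero] at h1
        exact ZMod.natCast_ne_zero_of_lt (k := k + 1 + 1) (by omega) hk (by exact_mod_cast h1)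
      rw [hc _ 0 (neg_ne_zero.mpr (ZMod.natCast_ne_zero_of_lt (by omega) (by omega))) h1,
        show -((k + 1 : ℕ) : ZMod s) - 1 = -((k + 1 + 1 : ℕ) : ZMod s) by push_cast; ring] at hb
      have := ih (by omega)
      omega
  have hpath' : ∀ i, i ≠ 0 → (p i).natAbs = 2 * (c 0 0).natAbs := by
    intro i hi
    have hpos : 0 < (-i).val := ZMod.val_pos.mpr (neg_ne_zero.mpr hi)
    have := hpath ((-i).val - 1) (by have := ZMod.val_lt (-i); omega)
    rwa [Nat.sub_add_cancel hpos, ZMod.natCast_zmod_val, neg_neg] at this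
  refine ⟨(hcyc 0).2, fun j => ?_, hpath'⟩
  rw [(hcyc 1).2 j]
  have h1 := hpath' 1 (ZMod.one_ne_zero_of_three_le hs)
  have hb := hbase 1
  rw [sub_self, hp] at hb
  omega

theorem sum_edges_eq_sum_add_sum {s l : ℕ} [NeZero s] [NeZero l] (hs : 3 ≤ s) (hl : 3 ≤ l)
    [Fintype (Gsl s l).edgeSet] {M : Type*} [AddCommMonoid M] (f : (Gsl s l).edgeSet → M) :
    ∑ e, f e =
      ∑ i, f (gslEdge hs hl (Sum.inl i)) + ∑ i, ∑ j, f (gslEdge hs hl (Sum.inr (i, j))) := by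
  rw [← (gslEdge_bijective hs hl).sum_comp, Fintype.sum_sum_type, Fintype.sum_prod_type]

theorem sum_eq_sum_of_sum_edgeExp_eq {V : Type*} [Fintype V] {ι : Type*} [Fintype ι]
    {φ : ι → Sym2 V} {u v : ι → ℕ} (h : ∑ e, u e • edgeExp (φ e) = ∑ e, v e • edgeExp (φ e)) :
    ∑ e, u e = ∑ e, v e := by
  have hdeg : ∀ e : Sym2 V, (edgeExp e).degree = 2 := by
    intro e
    induction e using Sym2.ind with
    | _ a b => simp [edgeExp]
  have := congrArg Finsupp.degree h
  simp only [map_sum, map_nsmul, hdeg, smul_eq_mul, ← Finset.sum_mul] at this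
  omega

theorem central_zero_notMem_circuitSupport {s l : ℕ} (hs : 3 ≤ s) (hl : 3 ≤ l) :
    (gslEdge hs hl (Sum.inl 0) : Sym2 (ZMod s × ZMod l)) ∉ circuitSupport s l := by
  have hinj := (gslEdge_bijective hs hl).1
  rintro ((⟨j, h⟩ | ⟨j, h⟩) | ⟨i, hi, h⟩)
  · exact Sum.inl_ne_inr (@hinj (Sum.inl 0) (Sum.inr (0, j)) (Subtype.ext h))
  · exact Sum.inl_ne_inr (@hinj (Sum.inl 0) (Sum.inr (1, j)) (Subtype.ext h))
  · exact hi (Sum.inl_injective (@hinj (Sum.inl 0) (Sum.inl i) (Subtype.ext h))).symm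

theorem attached_notMem_circuitSupport {s l : ℕ} (hs : 3 ≤ s) (hl : 3 ≤ l) {i : ZMod s}
    (h0 : i ≠ 0) (h1 : i ≠ 1) (j : ZMod l) :
    (gslEdge hs hl (Sum.inr (i, j)) : Sym2 (ZMod s × ZMod l)) ∉ circuitSupport s l := by
  have hinj := (gslEdge_bijective hs hl).1
  rintro ((⟨j', h⟩ | ⟨j', h⟩) | ⟨i', -, h⟩)
  · have := @hinj (Sum.inr (i, j)) (Sum.inr (0, j')) (Subtype.ext h)
    simp [h0] at this
  · have := @hinj (Sum.inr (i, j)) (Sum.inr (1, j')) (Subtype.ext h)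
    simp [h1] at this
  · exact Sum.inr_ne_inl (@hinj (Sum.inr (i, j)) (Sum.inl i') (Subtype.ext h))

theorem sum_central_multiplicity {s : ℕ} [NeZero s] :
    ∑ i : ZMod s, (if i = 0 then 0 else 2) = 2 * (s - 1) := by
  rw [Finset.sum_ite, Finset.sum_const_zero, zero_add, Finset.sum_const, Finset.filter_not,
    Finset.filter_eq', if_pos (Finset.mem_univ _), Finset.card_sdiff_of_subset (by simp)]
  simp [ZMod.card, mul_comm]

theorem sum_attached_multiplicity {s l : ℕ} [NeZero s] [NeZero l] (hs : 3 ≤ s) :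
    ∑ i : ZMod s, ∑ _j : ZMod l, (if i = 0 ∨ i = 1 then 1 else 0) = l + l := by
  have h01 : (0 : ZMod s) ≠ 1 := (ZMod.one_ne_zero_of_three_le hs).symm
  have hpair : (Finset.univ.filter fun i : ZMod s => i = 0 ∨ i = 1) = {0, 1} := by
    ext i
    simp
  simp only [Finset.sum_const, Finset.card_univ, ZMod.card, smul_eq_mul, ← Finset.mul_sum]
  rw [← Finset.card_filter, hpair, Finset.card_pair h01, mul_two]

theorem totalDegree_circuit {s l : ℕ} (hs : 3 ≤ s) (hl : 3 ≤ l) (hodd : Odd l)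
    {C : MvPolynomial (Gsl s l).edgeSet K}
    (hC : IsCircuitBinomial (graphToricIdeal K (Gsl s l)) C)
    (hsupp : (fun x : (Gsl s l).edgeSet => (x : Sym2 (ZMod s × ZMod l))) ''
        (C.vars : Set (Gsl s l).edgeSet) = circuitSupport s l) :
    C.totalDegree = l + s - 1 := by
  classical
  have : NeZero s := ⟨by omega⟩
  have : NeZero l := ⟨by omega⟩
  have : Fintype (Gsl s l).edgeSet := Fintype.ofBijective _ (gslEdge_bijective hs hl)
  obtain ⟨⟨u, v, huv, rfl⟩, hmem, hirr, -⟩ := hC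
  have hexp := sum_edgeExp_eq_of_binom_mem hmem
  have hzero : ∀ e : (Gsl s l).edgeSet, (e : Sym2 (ZMod s × ZMod l)) ∉ circuitSupport s l →
      (u e : ℤ) - v e = 0 := by
    intro e he
    have hvars : e ∉ (binom K u v).vars := fun h => he (hsupp ▸ ⟨e, h, rfl⟩)
    have hu := Finsupp.notMem_support_iff.mp
      fun h => hvars (support_subset_vars_binom_left huv h)
    have hv := Finsupp.notMem_support_iff.mp
      fun h => hvars (support_subset_vars_binom_right huv h)
    simp [hu, hv]
  let p : ZMod s → ℤ := fun i =>
    u (gslEdge hs hl (Sum.inl i)) - v (gslEdge hs hl (Sum.inl i))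
  let c : ZMod s → ZMod l → ℤ := fun i j =>
    u (gslEdge hs hl (Sum.inr (i, j))) - v (gslEdge hs hl (Sum.inr (i, j)))
  have hp : p 0 = 0 := hzero _ (central_zero_notMem_circuitSupport hs hl)
  have hc : ∀ i j, i ≠ 0 → i ≠ 1 → c i j = 0 := fun i j h0 h1 =>
    hzero _ (attached_notMem_circuitSupport hs hl h0 h1 j)
  obtain ⟨hc0, hc1, hpath⟩ := natAbs_eq_of_vertex_sum_eq_zero hs hl hodd hp hc fun i j => by
    have h := DFunLike.congr_fun hexp (i, j)
    rw [sum_edgeExp_apply hs hl, sum_edgeExp_apply hs hl] at h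
    simp only [p, c]
    split_ifs at h ⊢ <;> omega
  set n := (c 0 0).natAbs with hn
  have hall : ∀ x, ((u (gslEdge hs hl x) : ℤ) - v (gslEdge hs hl x)).natAbs =
      n * Sum.elim (fun i : ZMod s => if i = 0 then 0 else 2)
        (fun ij : ZMod s × ZMod l => if ij.1 = 0 ∨ ij.1 = 1 then 1 else 0) x := by
    rintro (i | ⟨i, j⟩)
    · rw [Sum.elim_inl]
      by_cases hi : i = 0
      · rw [if_pos hi, mul_zero, Int.natAbs_eq_zero, hi]
        exact hp
      · rw [if_neg hi, mul_comm]
        exact hpath i hi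
    · rw [Sum.elim_inr]
      by_cases hi : i = 0 ∨ i = 1
      · rw [if_pos hi, mul_one]
        rcases hi with rfl | rfl
        · exact hc0 j
        · exact hc1 j
      · rw [if_neg hi, mul_zero, Int.natAbs_eq_zero]
        rw [not_or] at hi
        exact hc i j hi.1 hi.2
  have hnpos : 0 < n := by
    rw [Nat.pos_iff_ne_zero]
    intro h0
    refine huv (Finsupp.ext fun e => ?_)
    obtain ⟨x, rfl⟩ := (gslEdge_bijective hs hl).2 e
    have := hall x
    rw [h0, zero_mul] at this
    omega
  have hdvd : ∀ e, ∃ k : ℤ, (u e : ℤ) - v e = n * k := by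
    intro e
    obtain ⟨x, rfl⟩ := (gslEdge_bijective hs hl).2 e
    exact Int.natCast_dvd.mpr ⟨_, hall x⟩
  choose w hw using hdvd
  have hwabs : ∀ x, (w (gslEdge hs hl x)).natAbs =
      Sum.elim (fun i : ZMod s => if i = 0 then 0 else 2)
        (fun ij : ZMod s × ZMod l => if ij.1 = 0 ∨ ij.1 = 1 then 1 else 0) x := by
    intro x
    have := hall x
    rw [hw, Int.natAbs_mul, Int.natAbs_natCast] at this
    exact Nat.eq_of_mul_eq_mul_left hnpos this
  have htwo := two_mul_totalDegree_of_irreducible_binom hirr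
    (sum_eq_sum_of_sum_edgeExp_eq hexp) hnpos hw
  rw [sum_edges_eq_sum_add_sum hs hl] at htwo
  simp only [hwabs, Sum.elim_inl, Sum.elim_inr] at htwo
  rw [sum_central_multiplicity, sum_attached_multiplicity hs] at htwo
  omega

/-- For the circuit `C` of `I_{G(s,l)}` given by the two attached `l`-cycles
at the central vertices `0` and `1` joined by the path of length `s - 1` inside the central
cycle, `deg C = l + s - 1` and the index of `C` is `1`: the lattice `ℤ·supp(C)` equals
`ℝ·supp(C) ∩ ℤA_{G(s,l)}`; hence the true degree of `C` equals `l + s - 1`. -/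
theorem circuit_index_eq_one (K : Type*) [Field K] (s l : ℕ)
    (hs : 3 ≤ s) (hl : 3 ≤ l) (hodd : Odd l)
    (C : MvPolynomial (Gsl s l).edgeSet K)
    (hC : IsCircuitBinomial (graphToricIdeal K (Gsl s l)) C)
    (hsupp : (fun x : (Gsl s l).edgeSet => (x : Sym2 (ZMod s × ZMod l))) ''
        (C.vars : Set (Gsl s l).edgeSet) = circuitSupport s l) :
    C.totalDegree = l + s - 1 ∧
      ∀ x : ZMod s × ZMod l → ℤ,
        x ∈ AddSubgroup.closure (edgeVec '' circuitSupport s l) ↔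
          (x ∈ AddSubgroup.closure (edgeVec '' (Gsl s l).edgeSet) ∧
            (fun v => (x v : ℝ)) ∈ Submodule.span ℝ
              ((fun e : Sym2 (ZMod s × ZMod l) => fun v => ((edgeVec e v : ℤ) : ℝ)) ''
                circuitSupport s l)) := by
  exact ⟨totalDegree_circuit hs hl hodd hC hsupp, mem_circuit_lattice_iff hs hl hodd⟩

end
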